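/- Let α > 0, let U ⊆ ℝ² be open, and let q : U → ℂ be continuously differentiable with Im q(x,t) > 0 for all (x,t) ∈ U, satisfying the elliptic Whitham equations ∂ₜq + (1/α)(1 − 3q − conj q)·∂ₓq = 0 and ∂ₜ(conj q) + (1/α)(1 − 3·conj q − q)·∂ₓ(conj q) = 0 on U. Define ρ(x,t) := (4/α²)·(Im √(q(x,t)))² and u(x,t) := (1 − 4|q(x,t)|)/α, where √ denotes the principal branch of the square root. Then: (i) ρ and u satisfy the dispersionless MNLS system ∂ₜρ + ∂ₓ(ρu + (3/2)αρ²) = 0 and ∂ₜu + ∂ₓ((1/2)u² − ρ + αρu) = 0 on U; (ii) the sonic quantity satisfies α²ρ + αu − 1 = −4(Re √q)² < 0 everywhere on U. -/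

import Mathlib

open Complex Real Filter Set Topology ComplexConjugate

noncomputable section

/-- The density `ρ = (4/α²)(Im √q)²` built from the Riemann invariant `q`
(principal branch square root). -/
def rhoOf (α : ℝ) (q : ℝ → ℝ → ℂ) (x t : ℝ) : ℝ :=
  (4/α^2) * (((q x t) ^ ((1:ℂ)/2)).im)^2

/-- The velocity `u = (1 − 4|q|)/α` built from the Riemann invariant `q`. -/
def uOf (α : ℝ) (q : ℝ → ℝ → ℂ) (x t : ℝ) : ℝ :=
  (1 - 4*‖q x t‖)/α

lemma cpow_half_sq (z : ℂ) : (z ^ ((1:ℂ)/2))^2 = z := by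
  rw [one_div]
  exact_mod_cast Complex.cpow_nat_inv_pow z two_ne_zero

/-- The norm of `z` in terms of the real and imaginary parts of its square root. -/
lemma norm_eq_re_sq_add_im_sq_cpow_half (z : ℂ) :
    ‖z‖ = ((z ^ ((1:ℂ)/2)).re)^2 + ((z ^ ((1:ℂ)/2)).im)^2 := by
  calc ‖z‖ = ‖(z ^ ((1:ℂ)/2))^2‖ := by rw [cpow_half_sq]
    _ = _ := by
      rw [norm_pow, Complex.sq_norm, Complex.normSq_apply]
      ring

/-- Along a differentiable curve in the slit plane the principal square root is differentiable, with
derivative `d` such that `2 √f d = f'`. -/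
lemma exists_hasDerivAt_cpow_half {f : ℝ → ℂ} {y : ℝ} (hf : DifferentiableAt ℝ f y)
    (hs : f y ∈ slitPlane) :
    ∃ d : ℂ, 2 * (f y) ^ ((1:ℂ)/2) * d = deriv f y ∧
      HasDerivAt (fun x => ((f x) ^ ((1:ℂ)/2)).re) d.re y ∧
      HasDerivAt (fun x => ((f x) ^ ((1:ℂ)/2)).im) d.im y := by
  have hc : HasDerivAt (fun z : ℂ => z ^ ((1:ℂ)/2)) _ (f y) :=
    (hasDerivAt_id (f y)).cpow_const (c := (1:ℂ)/2) hs
  have h := hc.comp_of_eq y hf.hasDerivAt rfl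
  have hd : DifferentiableAt ℝ (fun x => (f x) ^ ((1:ℂ)/2)) y := h.differentiableAt
  refine ⟨_, ?_, Complex.reCLM.hasFDerivAt.comp_hasDerivAt y hd.hasDerivAt,
    Complex.imCLM.hasFDerivAt.comp_hasDerivAt y hd.hasDerivAt⟩
  have h2 := (hd.hasDerivAt.pow 2).deriv
  have he : (fun x => (f x) ^ ((1:ℂ)/2)) ^ 2 = f := funext fun x => cpow_half_sq (f x)
  rw [he] at h2
  rw [h2]
  norm_num

/-- the elliptic Whitham system is the dispersionless MNLS system in
Riemann-invariant form, and the corresponding state is strictly subsonic. -/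
theorem whitham_gives_dispersionless_MNLS (α : ℝ) (hα : 0 < α)
    (U : Set (ℝ × ℝ)) (hU : IsOpen U)
    (q : ℝ → ℝ → ℂ)
    (hC1 : ContDiffOn ℝ 1 (fun p : ℝ × ℝ => q p.1 p.2) U)
    (him : ∀ x t : ℝ, (x, t) ∈ U → 0 < (q x t).im)
    (hW1 : ∀ x t : ℝ, (x, t) ∈ U →
      deriv (fun τ => q x τ) t
        + (1/(α:ℂ)) * (1 - 3*q x t - conj (q x t)) * deriv (fun y => q y t) x = 0)
    (hW2 : ∀ x t : ℝ, (x, t) ∈ U →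
      deriv (fun τ => conj (q x τ)) t
        + (1/(α:ℂ)) * (1 - 3*conj (q x t) - q x t) * deriv (fun y => conj (q y t)) x = 0) :
    ∀ x t : ℝ, (x, t) ∈ U →
      -- (i) the dispersionless MNLS system
      (deriv (fun τ => rhoOf α q x τ) t
        + deriv (fun y => rhoOf α q y t * uOf α q y t + (3/2)*α*(rhoOf α q y t)^2) x = 0) ∧
      (deriv (fun τ => uOf α q x τ) t
        + deriv (fun y => (1/2)*(uOf α q y t)^2 - rhoOf α q y t
            + α*(rhoOf α q y t)*(uOf α q y t)) x = 0) ∧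
      -- (ii) strict subsonicity
      α^2 * rhoOf α q x t + α * uOf α q x t - 1
        = -4 * (((q x t) ^ ((1:ℂ)/2)).re)^2 ∧
      α^2 * rhoOf α q x t + α * uOf α q x t - 1 < 0 := by
  intro x t hxt
  have hd : DifferentiableAt ℝ (fun p : ℝ × ℝ => q p.1 p.2) (x, t) :=
    (hC1.contDiffAt (hU.mem_nhds hxt)).differentiableAt one_ne_zero
  have hdx : DifferentiableAt ℝ (fun y => q y t) x :=
    hd.comp (f := fun y : ℝ => (y, t)) x (by fun_prop)
  have hdt : DifferentiableAt ℝ (fun τ => q x τ) t :=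
    hd.comp (f := fun τ : ℝ => (x, τ)) t (by fun_prop)
  have him0 := him x t hxt
  have hslit : q x t ∈ slitPlane := Or.inr him0.ne'
  obtain ⟨dx, hdx', hax, hbx⟩ := exists_hasDerivAt_cpow_half hdx hslit
  obtain ⟨dt, hdt', hat, hbt⟩ := exists_hasDerivAt_cpow_half hdt hslit
  have hW := hW1 x t hxt
  rw [← hdx', ← hdt'] at hW
  have hsq := cpow_half_sq (q x t)
  simp only [rhoOf, uOf, norm_eq_re_sq_add_im_sq_cpow_half]
  have hα' : (α:ℂ) ≠ 0 := by exact_mod_cast hα.ne'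
  have hα0 := hα.ne'
  set s := (q x t) ^ ((1:ℂ)/2) with hs
  have hs0 : s ≠ 0 := by
    intro h
    rw [← hsq, h] at him0
    simp at him0
  have hre : s.re ≠ 0 := by
    intro h
    rw [← hsq, pow_two, mul_im, h] at him0
    simp at him0
  have hE : (α:ℂ) * dt + (1 - 3*s^2 - conj s^2) * dx = 0 := by
    rw [← hsq, map_pow] at hW
    refine mul_left_cancel₀ (mul_ne_zero two_ne_zero hs0) ?_
    field_simp at hW
    linear_combination hW
  have hEre := congrArg Complex.re hE
  have hEim := congrArg Complex.im hE
  simp [pow_two] at hEre hEim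
  have hρt := (hbt.pow 2).const_mul (4/α^2)
  have hρx := (hbx.pow 2).const_mul (4/α^2)
  have hut := ((((hat.pow 2).add (hbt.pow 2)).const_mul 4).const_sub 1).div_const α
  have hux := ((((hax.pow 2).add (hbx.pow 2)).const_mul 4).const_sub 1).div_const α
  have hF := (hρx.mul hux).add ((hρx.pow 2).const_mul ((3/2)*α))
  have hG := (((hux.pow 2).const_mul (1/2)).sub hρx).add ((hρx.const_mul α).mul hux)
  refine ⟨?_, ?_, ?_, ?_⟩
  · refine (congrArg₂ (· + ·) hρt.deriv hF.deriv).trans ?_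
    simp only [Pi.pow_apply, Pi.add_apply, Nat.add_one_sub_one, pow_one, Nat.cast_ofNat, ← hs]
    linear_combination (norm := (field_simp; ring)) (8*s.im/α^3) * hEim
  · refine (congrArg₂ (· + ·) hut.deriv hG.deriv).trans ?_
    simp only [Pi.pow_apply, Pi.add_apply, Nat.add_one_sub_one, pow_one, Nat.cast_ofNat, ← hs]
    linear_combination (norm := (field_simp; ring)) (-8/α^2) * (s.re*hEre + s.im*hEim)
  · field_simp
    ring
  · have : 0 < s.re^2 := by positivity
    field_simp
    nlinarith
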